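/- Let a, b, c ∈ ℝ and λ > 0 with b < 0, c < 0 and Disc(P) := a²b² + 4b³ − 4a³c − 18abc − 27c² < 0. Then the discrete-time Hawkes chain with memory 3 and parameters (a,b,c,λ) is geometrically ergodic: there exists a probability measure π on ℕ³ invariant under the transition kernel P, a constant ρ ∈ (0,1) and a function C : ℕ³ → [0,∞) such that for every state x ∈ ℕ³ and every n ∈ ℕ, the total variation distance between the n-step transition law P^n(x,·) and π is at most C(x)·ρ^n. -/

import Mathlib

open scoped BigOperators
open Classical

/-- The Poisson probability mass function with parameter `s` at `k`
(with the convention that a Poisson variable of parameter `0` is identically `0`). -/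
noncomputable def poissonPMF (s : ℝ) (k : ℕ) : ℝ :=
  Real.exp (-s) * s ^ k / (Nat.factorial k)

/-- The (truncated) intensity `s_{ijk} = max(ai + bj + ck + λ, 0)`. -/
noncomputable def s3 (a b c lam : ℝ) (x : ℕ × ℕ × ℕ) : ℝ :=
  max (a * x.1 + b * x.2.1 + c * x.2.2 + lam) 0

/-- Transition kernel of the discrete-time Hawkes chain with memory `3`:
from `(i,j,k)` the chain moves to `(ℓ,i,j)` with `ℓ` Poisson distributed
with parameter `s_{ijk}`. -/
noncomputable def hawkes3P (a b c lam : ℝ) (x y : ℕ × ℕ × ℕ) : ℝ :=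
  if y.2.1 = x.1 ∧ y.2.2 = x.2.1 then poissonPMF (s3 a b c lam x) y.1 else 0

/-- `n`-step transition kernel of a Markov kernel `P` on a countable state space. -/
noncomputable def kernelPow {S : Type*} (P : S → S → ℝ) : ℕ → S → S → ℝ
  | 0 => fun x y => if x = y then 1 else 0
  | n + 1 => fun x y => ∑' z, kernelPow P n x z * P z y

/-- Total variation distance between two (sub)probability vectors on a countable space. -/
noncomputable def tvDist {S : Type*} (μ ν : S → ℝ) : ℝ :=
  (1 / 2) * ∑' y, |μ y - ν y|


/-- Action of a (signed) kernel on a (signed) vector. -/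
noncomputable def hop {I S : Type*} (μ : I → ℝ) (M : I → S → ℝ) (y : S) : ℝ := ∑' i, μ i * M i y

section harris

variable {I S : Type*}

lemma hop_fub (μ : I → ℝ) (M : I → S → ℝ) (w : S → ℝ) (g : I → ℝ) (hw : ∀ y, 0 ≤ w y)
    (hM : ∀ i, Summable fun y => w y * |M i y|) (hg : ∀ i, ∑' y, w y * |M i y| ≤ g i)
    (hμ : Summable fun i => |μ i| * g i) :
    Summable (fun p : I × S => |μ p.1| * (w p.2 * |M p.1 p.2|)) := by
  refine (summable_prod_of_nonneg ?_).2 ⟨fun i => ?_, ?_⟩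
  · intro p
    exact mul_nonneg (abs_nonneg _) (mul_nonneg (hw _) (abs_nonneg _))
  · exact (hM i).mul_left |μ i|
  · refine Summable.of_nonneg_of_le (fun i => ?_) (fun i => ?_) hμ
    · exact tsum_nonneg fun y => mul_nonneg (abs_nonneg _) (mul_nonneg (hw _) (abs_nonneg _))
    · simp only [tsum_mul_left]
      exact mul_le_mul_of_nonneg_left (hg i) (abs_nonneg _)

lemma hop_bound (μ : I → ℝ) (M : I → S → ℝ) (w : S → ℝ) (g : I → ℝ) (hw : ∀ y, 0 ≤ w y)
    (hM : ∀ i, Summable fun y => w y * |M i y|) (hg : ∀ i, ∑' y, w y * |M i y| ≤ g i)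
    (hμ : Summable fun i => |μ i| * g i) :
    Summable (fun y => w y * |hop μ M y|) ∧ ∑' y, w y * |hop μ M y| ≤ ∑' i, |μ i| * g i := by
  have h := hop_fub μ M w g hw hM hg hμ
  have h' := h.prod_symm
  have hcol : ∀ y, Summable fun i => |μ i| * (w y * |M i y|) := fun y => h'.prod_factor y
  have hle : ∀ y, w y * |hop μ M y| ≤ ∑' i, |μ i| * (w y * |M i y|) := by
    intro y
    have e : w y * |hop μ M y| = ‖∑' i, w y * (μ i * M i y)‖ := by
      rw [tsum_mul_left, Real.norm_eq_abs, abs_mul, abs_of_nonneg (hw y)]; rfl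
    have e2 : ∀ i, ‖w y * (μ i * M i y)‖ = |μ i| * (w y * |M i y|) := by
      intro i
      rw [Real.norm_eq_abs, abs_mul, abs_mul, abs_of_nonneg (hw y)]; ring
    rw [e]
    refine (norm_tsum_le_tsum_norm ?_).trans ?_
    · simp only [e2]; exact hcol y
    · simp only [e2]; exact le_rfl
  have hs : Summable (fun y => ∑' i, |μ i| * (w y * |M i y|)) := h'.prod
  have hS : Summable (fun y => w y * |hop μ M y|) :=
    Summable.of_nonneg_of_le (fun y => mul_nonneg (hw _) (abs_nonneg _)) hle hs
  refine ⟨hS, (Summable.tsum_le_tsum hle hS hs).trans ?_⟩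
  have hc : ∑' y, ∑' i, |μ i| * (w y * |M i y|) = ∑' i, ∑' y, |μ i| * (w y * |M i y|) :=
    Summable.tsum_comm (f := fun i y => |μ i| * (w y * |M i y|)) h
  rw [hc]
  refine Summable.tsum_le_tsum (fun i => ?_) h.prod hμ
  rw [tsum_mul_left]
  exact mul_le_mul_of_nonneg_left (hg i) (abs_nonneg _)

lemma hop_fub1 (μ : I → ℝ) (M : I → S → ℝ) (g : I → ℝ)
    (hM : ∀ i, Summable fun y => |M i y|) (hg : ∀ i, ∑' y, |M i y| ≤ g i)
    (hμ : Summable fun i => |μ i| * g i) :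
    Summable (fun p : I × S => |μ p.1| * |M p.1 p.2|) := by
  simpa using hop_fub μ M (fun _ => 1) g (fun _ => zero_le_one) (by simpa using hM)
    (by simpa using hg) hμ

lemma hop_bound1 (μ : I → ℝ) (M : I → S → ℝ) (g : I → ℝ)
    (hM : ∀ i, Summable fun y => |M i y|) (hg : ∀ i, ∑' y, |M i y| ≤ g i)
    (hμ : Summable fun i => |μ i| * g i) :
    Summable (fun y => |hop μ M y|) ∧ ∑' y, |hop μ M y| ≤ ∑' i, |μ i| * g i := by
  simpa using hop_bound μ M (fun _ => 1) g (fun _ => zero_le_one) (by simpa using hM)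
    (by simpa using hg) hμ

lemma hop_summable (μ : I → ℝ) (M : I → S → ℝ) (g : I → ℝ)
    (hM : ∀ i, Summable fun y => |M i y|) (hg : ∀ i, ∑' y, |M i y| ≤ g i)
    (hμ : Summable fun i => |μ i| * g i) (y : S) : Summable fun i => μ i * M i y := by
  have h := (hop_fub1 μ M g hM hg hμ).prod_symm.prod_factor y
  refine Summable.of_norm_bounded h fun i => ?_
  simp

lemma hop_sum (μ : I → ℝ) (M : I → S → ℝ) (g : I → ℝ)
    (hM : ∀ i, Summable fun y => |M i y|) (hg : ∀ i, ∑' y, |M i y| ≤ g i)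
    (hμ : Summable fun i => |μ i| * g i) :
    ∑' y, hop μ M y = ∑' i, μ i * ∑' y, M i y := by
  have h : Summable (Function.uncurry fun i y => μ i * M i y) := by
    refine Summable.of_norm_bounded (hop_fub1 μ M g hM hg hμ) fun p => ?_
    simp [Function.uncurry]
  have := h.tsum_comm
  simp only [tsum_mul_left] at this
  exact this

lemma hop_assoc {J : Type*} (μ : I → ℝ) (M : I → S → ℝ) (g : I → ℝ)
    (hM : ∀ i, Summable fun y => |M i y|) (hg : ∀ i, ∑' y, |M i y| ≤ g i)
    (hμ : Summable fun i => |μ i| * g i) (Q : S → J → ℝ) (hQ : ∀ y z, |Q y z| ≤ 1) :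
    hop (hop μ M) Q = hop μ (fun i => hop (M i) Q) := by
  funext z
  have h : Summable (Function.uncurry fun i y => μ i * (M i y * Q y z)) := by
    refine Summable.of_norm_bounded (hop_fub1 μ M g hM hg hμ) fun p => ?_
    simp only [Function.uncurry, Real.norm_eq_abs, abs_mul]
    have := mul_le_mul_of_nonneg_left (hQ p.2 z) (abs_nonneg (M p.1 p.2))
    rw [mul_one] at this
    exact mul_le_mul_of_nonneg_left this (abs_nonneg _)
  have := h.tsum_comm
  simp only [tsum_mul_left] at this
  unfold hop
  rw [← this]
  refine tsum_congr fun y => ?_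
  rw [← tsum_mul_right]
  exact tsum_congr fun i => by ring

end harris

section harris2

variable {S : Type*} (P : S → S → ℝ)

lemma kp_nonneg (hP0 : ∀ x y, 0 ≤ P x y) (n : ℕ) (x y : S) : 0 ≤ kernelPow P n x y := by
  induction n generalizing y with
  | zero => unfold kernelPow; split_ifs <;> simp
  | succ n ih => exact tsum_nonneg fun z => mul_nonneg (ih z) (hP0 z y)

lemma kp_hasSum (hP0 : ∀ x y, 0 ≤ P x y) (hP1 : ∀ x, HasSum (P x) 1) (n : ℕ) (x : S) :
    HasSum (kernelPow P n x) 1 := by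
  induction n with
  | zero =>
    have := hasSum_ite_eq x (1 : ℝ)
    convert this using 1
    funext y
    unfold kernelPow
    by_cases h : x = y
    · simp [h]
    · simp [h, Ne.symm h]
  | succ n ih =>
    have hM : ∀ i, Summable fun y => |P i y| := fun i => by
      simpa only [abs_of_nonneg (hP0 i _)] using (hP1 i).summable
    have hg : ∀ i, ∑' y, |P i y| ≤ 1 := fun i => by
      simp only [abs_of_nonneg (hP0 i _), (hP1 i).tsum_eq, le_refl]
    have hμ : Summable fun i => |kernelPow P n x i| * 1 := by
      simpa only [abs_of_nonneg (kp_nonneg P hP0 n x _), mul_one] using ih.summable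
    have h1 := (hop_bound1 (kernelPow P n x) P (fun _ => 1) hM hg hμ).1
    have h2 := hop_sum (kernelPow P n x) P (fun _ => 1) hM hg hμ
    have h3 : Summable (hop (kernelPow P n x) P) := Summable.of_abs h1
    have h4 : ∑' y, hop (kernelPow P n x) P y = 1 := by
      rw [h2]; simp only [(hP1 _).tsum_eq, mul_one]; exact ih.tsum_eq
    rw [← h4]; exact h3.hasSum

lemma hop_delta (M : S → S → ℝ) (x : S) : hop (fun y => if x = y then (1 : ℝ) else 0) M = M x := by
  funext y
  unfold hop
  rw [tsum_eq_single x]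
  · simp
  · intro z hz
    simp [Ne.symm hz]

lemma harris_core (hP0 : ∀ x y, 0 ≤ P x y) (hP1 : ∀ x, HasSum (P x) 1)
    (w : S → ℝ) (hw : ∀ y, 1 ≤ w y) (C1 : ℝ) (hC1 : 1 ≤ C1)
    (hPw : ∀ x, Summable fun y => w y * P x y) (hPC : ∀ x, ∑' y, w y * P x y ≤ C1 * w x)
    (o : S) (ε α : ℝ) (hα0 : 0 < α) (hα1 : α < 1)
    (hKs : ∀ x, Summable fun y => w y * |kernelPow P 3 x y - ε * (if o = y then 1 else 0)|)
    (hK : ∀ x, ∑' y, w y * |kernelPow P 3 x y - ε * (if o = y then 1 else 0)| ≤ α * w x) :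
    ∃ π : S → ℝ,
      (∀ x, 0 ≤ π x) ∧ (∑' x, π x = 1) ∧
      (∀ y, ∑' x, π x * P x y = π y) ∧
      ∃ ρ : ℝ, ρ ∈ Set.Ioo (0 : ℝ) 1 ∧
        ∃ C : S → ℝ, (∀ x, 0 ≤ C x) ∧
          ∀ (x : S) (n : ℕ),
            tvDist (kernelPow P n x) π ≤ C x * ρ ^ n := by
  have hw0 : ∀ y, 0 ≤ w y := fun y => zero_le_one.trans (hw y)
  set N : (S → ℝ) → ℝ := fun μ => ∑' y, w y * |μ y| with hN
  set G : (S → ℝ) → Prop := fun μ => Summable fun y => w y * |μ y| with hG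
  have hN0 : ∀ μ, 0 ≤ N μ := fun μ => tsum_nonneg fun y => mul_nonneg (hw0 _) (abs_nonneg _)
  have hGabs : ∀ μ, G μ → Summable fun y => |μ y| := fun μ h =>
    Summable.of_nonneg_of_le (fun y => abs_nonneg _)
      (fun y => le_mul_of_one_le_left (abs_nonneg _) (hw y)) h
  have hGN : ∀ μ, G μ → ∑' y, |μ y| ≤ N μ := fun μ h =>
    Summable.tsum_le_tsum (fun y => le_mul_of_one_le_left (abs_nonneg _) (hw y)) (hGabs μ h) h
  have hGS : ∀ μ, G μ → Summable μ := fun μ h => Summable.of_abs (hGabs μ h)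
  have hPabs : ∀ i y, |P i y| = P i y := fun i y => abs_of_nonneg (hP0 i y)
  have hPs : ∀ i, Summable fun y => |P i y| := fun i => by
    simpa only [hPabs] using (hP1 i).summable
  have hPt : ∀ i, ∑' y, |P i y| ≤ 1 := fun i => by
    simp only [hPabs, (hP1 i).tsum_eq, le_refl]
  have hPle : ∀ x y, |P x y| ≤ 1 := fun x y => by
    rw [hPabs, ← (hP1 x).tsum_eq]
    exact (hP1 x).summable.le_tsum y fun z _ => hP0 x z
  have hKabs : ∀ n i y, |kernelPow P n i y| = kernelPow P n i y :=
    fun n i y => abs_of_nonneg (kp_nonneg P hP0 n i y)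
  have hKsum : ∀ n i, Summable fun y => |kernelPow P n i y| := fun n i => by
    simpa only [hKabs] using (kp_hasSum P hP0 hP1 n i).summable
  have hKt : ∀ n i, ∑' y, |kernelPow P n i y| ≤ 1 := fun n i => by
    simp only [hKabs, (kp_hasSum P hP0 hP1 n i).tsum_eq, le_refl]
  set A : (S → ℝ) → (S → ℝ) := fun μ => hop μ P with hA
  -- one step
  have hA1 : ∀ μ, G μ → G (A μ) ∧ N (A μ) ≤ C1 * N μ := by
    intro μ h
    have := hop_bound μ P w (fun x => C1 * w x) hw0 (by simpa only [hPabs] using hPw)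
      (by simpa only [hPabs] using hPC) (by
        have := h.mul_left C1
        refine this.congr fun y => by ring)
    refine ⟨this.1, this.2.trans (le_of_eq ?_)⟩
    rw [hN, ← tsum_mul_left]
    exact tsum_congr fun y => by ring
  have hAG : ∀ μ, G μ → ∀ n, G (A^[n] μ) := by
    intro μ h n
    induction n with
    | zero => exact h
    | succ n ih => rw [Function.iterate_succ_apply']; exact (hA1 _ ih).1
  have hA0 : ∀ μ, G μ → ∑' y, A μ y = ∑' y, μ y := by
    intro μ h
    have := hop_sum μ P (fun _ => 1) hPs hPt (by simpa using hGabs μ h)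
    rw [hA]
    simp only [this, (hP1 _).tsum_eq, mul_one]
  have hAn : ∀ μ, G μ → ∀ n, A^[n] μ = hop μ (kernelPow P n) := by
    intro μ h n
    induction n with
    | zero =>
      funext y
      unfold hop kernelPow
      rw [tsum_eq_single y]
      · simp
      · intro z hz
        simp [hz]
    | succ n ih =>
      rw [Function.iterate_succ_apply', ih]
      exact hop_assoc μ (kernelPow P n) (fun _ => 1) (hKsum n) (hKt n)
        (by simpa using hGabs μ h) P hPle
  have hAsub : ∀ μ ν, G μ → G ν → ∀ n, A^[n] (fun y => μ y - ν y) = fun y => A^[n] μ y - A^[n] ν y := by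
    intro μ ν hμ hν n
    have hμν : G (fun y => μ y - ν y) := by
      refine Summable.of_nonneg_of_le (fun y => mul_nonneg (hw0 _) (abs_nonneg _)) (fun y => ?_)
        (Summable.add hμ hν)
      rw [← mul_add]
      exact mul_le_mul_of_nonneg_left (abs_sub _ _) (hw0 y)
    rw [hAn _ hμν, hAn _ hμ, hAn _ hν]
    funext y
    unfold hop
    rw [← Summable.tsum_sub]
    · exact tsum_congr fun i => by ring
    · exact hop_summable μ (kernelPow P n) (fun _ => 1) (hKsum n) (hKt n)
        (by simpa using hGabs μ hμ) y
    · exact hop_summable ν (kernelPow P n) (fun _ => 1) (hKsum n) (hKt n)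
        (by simpa using hGabs ν hν) y
  have hsubG : ∀ μ ν, G μ → G ν → G (fun y => μ y - ν y) := by
    intro μ ν hμ hν
    refine Summable.of_nonneg_of_le (fun y => mul_nonneg (hw0 _) (abs_nonneg _)) (fun y => ?_)
      (Summable.add hμ hν)
    rw [← mul_add]
    exact mul_le_mul_of_nonneg_left (abs_sub _ _) (hw0 y)
  -- contraction for three steps
  have hA3 : ∀ μ, G μ → ∑' y, μ y = 0 → N (A^[3] μ) ≤ α * N μ := by
    intro μ h h0
    have e : A^[3] μ = hop μ (fun x y => kernelPow P 3 x y - ε * (if o = y then 1 else 0)) := by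
      rw [hAn μ h 3]
      funext y
      unfold hop
      have hs := hop_summable μ (kernelPow P 3) (fun _ => 1) (hKsum 3) (hKt 3)
        (by simpa using hGabs μ h) y
      have hs2 : Summable fun i => μ i * (ε * (if o = y then (1 : ℝ) else 0)) :=
        (hGS μ h).mul_right _
      simp only [mul_sub]
      rw [hs.tsum_sub hs2, tsum_mul_right, h0]
      ring
    rw [e]
    have := hop_bound μ (fun x y => kernelPow P 3 x y - ε * (if o = y then 1 else 0)) w
      (fun x => α * w x) hw0 hKs hK (by
        have := h.mul_left α
        refine this.congr fun y => by ring)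
    refine this.2.trans (le_of_eq ?_)
    rw [hN, ← tsum_mul_left]
    exact tsum_congr fun y => by ring
  have hAn0 : ∀ μ, G μ → ∀ n, ∑' y, A^[n] μ y = ∑' y, μ y := by
    intro μ h n
    induction n with
    | zero => rfl
    | succ n ih => rw [Function.iterate_succ_apply', hA0 _ (hAG μ h n), ih]
  set ρ : ℝ := α ^ ((1 : ℝ) / 3) with hρ
  have hρ0 : 0 < ρ := Real.rpow_pos_of_pos hα0 _
  have hρ1 : ρ < 1 := Real.rpow_lt_one hα0.le hα1 (by norm_num)
  have hρ3 : ρ ^ 3 = α := by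
    rw [hρ, ← Real.rpow_natCast, ← Real.rpow_mul hα0.le]; norm_num
  set C2 : ℝ := C1 ^ 2 / α with hC2
  have hC20 : 0 ≤ C2 := by positivity
  have hdecay : ∀ n μ, G μ → ∑' y, μ y = 0 → N (A^[n] μ) ≤ C2 * ρ ^ n * N μ := by
    intro n
    induction n using Nat.strong_induction_on with
    | _ n ih =>
      intro μ h h0
      by_cases hn : n < 3
      · have h1 : ∀ k, N (A^[k] μ) ≤ C1 ^ k * N μ := by
          intro k
          induction k with
          | zero => simp
          | succ k ih2 =>
            rw [Function.iterate_succ_apply', pow_succ']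
            refine ((hA1 _ (hAG μ h k)).2).trans ?_
            rw [mul_assoc]
            exact mul_le_mul_of_nonneg_left ih2 (by linarith)
        refine (h1 n).trans (mul_le_mul_of_nonneg_right ?_ (hN0 μ))
        have h2 : C1 ^ n ≤ C1 ^ 2 := pow_le_pow_right₀ hC1 (by omega)
        have h3 : α ≤ ρ ^ n := by
          rw [← hρ3]; exact pow_le_pow_of_le_one hρ0.le hρ1.le (by omega)
        rw [hC2, div_mul_eq_mul_div, le_div_iff₀ hα0]
        exact mul_le_mul h2 h3 hα0.le (by positivity)
      · obtain ⟨m, rfl⟩ : ∃ m, n = m + 3 := ⟨n - 3, by omega⟩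
        rw [Function.iterate_add_apply]
        refine (ih m (by omega) _ (hAG μ h 3) ((hAn0 μ h 3).trans h0)).trans ?_
        have := mul_le_mul_of_nonneg_left (hA3 μ h h0) (a := C2 * ρ ^ m) (by positivity)
        refine this.trans (le_of_eq ?_)
        rw [pow_add, hρ3]; ring
  -- delta masses
  set δ : S → S → ℝ := fun x y => if x = y then (1 : ℝ) else 0 with hδ
  have hδG : ∀ x, G (δ x) := by
    intro x
    refine summable_of_ne_finset_zero (s := {x}) fun y hy => ?_
    have : x ≠ y := fun h => hy (by simp [h])
    simp [hδ, this]
  have hδsum : ∀ x, ∑' y, δ x y = 1 := fun x => (kp_hasSum P hP0 hP1 0 x).tsum_eq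
  have hkp : ∀ n x, kernelPow P n x = A^[n] (δ x) := by
    intro n x
    rw [hAn _ (hδG x)]
    exact (hop_delta _ x).symm
  -- increments
  set d : ℕ → S → ℝ := fun k y => A^[k] (fun z => A (δ o) z - δ o z) y with hd
  have hAδ : G (A (δ o)) := (hA1 _ (hδG o)).1
  have hd0G : G (fun z => A (δ o) z - δ o z) := hsubG _ _ hAδ (hδG o)
  have hdG : ∀ k, G (d k) := fun k => hAG _ hd0G k
  have hd0s : ∑' z, (A (δ o) z - δ o z) = 0 := by
    rw [(hGS _ hAδ).tsum_sub (hGS _ (hδG o)), hA0 _ (hδG o), sub_self]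
  set B : ℝ := C2 * N (fun z => A (δ o) z - δ o z) with hB
  have hdN : ∀ k, N (d k) ≤ B * ρ ^ k := by
    intro k
    refine (hdecay k _ hd0G hd0s).trans (le_of_eq ?_)
    rw [hB]; ring
  have hdsum : ∀ k, ∑' y, d k y = 0 := fun k => (hAn0 _ hd0G k).trans hd0s
  have hde : ∀ k y, d k y = kernelPow P (k + 1) o y - kernelPow P k o y := by
    intro k y
    rw [hkp, hkp, hd]
    simp only
    rw [hAsub _ _ hAδ (hδG o), Function.iterate_succ_apply]
  have hgeo : Summable fun k : ℕ => |(1 : ℝ)| * (B * ρ ^ k) := by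
    simp only [abs_one, one_mul]
    exact (summable_geometric_of_lt_one hρ0.le hρ1).mul_left B
  have hd1 : ∀ k, Summable fun y => |d k y| := fun k => hGabs _ (hdG k)
  have hd2 : ∀ k, ∑' y, |d k y| ≤ B * ρ ^ k := fun k => (hGN _ (hdG k)).trans (hdN k)
  set e : S → ℝ := hop (fun _ : ℕ => (1 : ℝ)) d with he
  have heG : G e := (hop_bound (fun _ : ℕ => (1 : ℝ)) d w (fun k => B * ρ ^ k) hw0 hdG hdN hgeo).1
  have hes : ∑' y, e y = 0 := by
    have := hop_sum (fun _ : ℕ => (1 : ℝ)) d (fun k => B * ρ ^ k) hd1 hd2 hgeo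
    rw [he, this]
    simp [hdsum]
  have hdk : ∀ y, Summable fun k => d k y := by
    intro y
    simpa using hop_summable (fun _ : ℕ => (1 : ℝ)) d (fun k => B * ρ ^ k) hd1 hd2 hgeo y
  have hee : ∀ y, e y = ∑' k, d k y := by
    intro y; simp [he, hop]
  have hAe : ∀ y, A e y = ∑' k, d (k + 1) y := by
    intro y
    have := hop_assoc (fun _ : ℕ => (1 : ℝ)) d (fun k => B * ρ ^ k) hd1 hd2 hgeo P hPle
    have h2 := congrFun this y
    rw [hA, he]
    simp only
    rw [h2]
    unfold hop
    simp only [one_mul]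
    refine tsum_congr fun k => ?_
    simp only [hd]
    rw [Function.iterate_succ_apply']
    rfl
  set π : S → ℝ := fun y => δ o y - (fun z => - e z) y with hπ
  have hnegG : G (fun z => - e z) := by
    simpa only [hG, abs_neg] using heG
  have hπG : G π := hsubG _ _ (hδG o) hnegG
  have hAneg : A (fun z => - e z) = fun z => - A e z := by
    funext z
    simp [hA, hop, tsum_neg]
  have hinv : A π = π := by
    have := hAsub _ _ (hδG o) hnegG 1
    simp only [Function.iterate_one] at this
    rw [hπ, this, hAneg]
    funext y
    have h0 : d 0 y = A (δ o) y - δ o y := rfl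
    change A (δ o) y - -A e y = δ o y - -e y
    rw [hAe, hee, (hdk y).tsum_eq_zero_add, h0]
    ring
  have hπsum : ∑' y, π y = 1 := by
    rw [hπ, (hGS _ (hδG o)).tsum_sub (hGS _ hnegG), hδsum, tsum_neg, hes]
    simp
  have hπ0 : ∀ y, 0 ≤ π y := by
    intro y
    have h1 := (hdk y).hasSum.tendsto_sum_nat
    have h2 : ∀ n, ∑ k ∈ Finset.range n, d k y = kernelPow P n o y - kernelPow P 0 o y := by
      intro n
      simp only [hde]
      exact Finset.sum_range_sub (fun k => kernelPow P k o y) n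
    have h3 : -(δ o y) ≤ e y := by
      rw [hee]
      refine ge_of_tendsto' h1 fun n => ?_
      rw [h2]
      have := kp_nonneg P hP0 n o y
      have h4 : kernelPow P 0 o y = δ o y := rfl
      linarith
    simp only [hπ]
    linarith
  have hinvn : ∀ n, A^[n] π = π := fun n => Function.iterate_fixed hinv n
  refine ⟨π, hπ0, hπsum, fun y => congrFun hinv y, ρ, ⟨hρ0, hρ1⟩,
    fun x => C2 * N (fun y => δ x y - π y), fun x => mul_nonneg hC20 (hN0 _), fun x n => ?_⟩
  have hG1 := hsubG _ _ (hδG x) hπG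
  have hz : ∑' y, (δ x y - π y) = 0 := by
    rw [(hGS _ (hδG x)).tsum_sub (hGS _ hπG), hδsum, hπsum, sub_self]
  have hfin := hdecay n _ hG1 hz
  have hle := hGN _ (hAG _ hG1 n)
  rw [hAsub _ _ (hδG x) hπG, hinvn, ← hkp] at hfin hle
  unfold tvDist
  have hnn : 0 ≤ ∑' y, |kernelPow P n x y - π y| := tsum_nonneg fun y => abs_nonneg _
  calc (1 / 2) * ∑' y, |kernelPow P n x y - π y| ≤ ∑' y, |kernelPow P n x y - π y| := by linarith
    _ ≤ _ := hle
    _ ≤ _ := hfin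
    _ = _ := by ring

end harris2

section harris3

variable {S : Type*} (P : S → S → ℝ)

lemma kp_drift (hP0 : ∀ x y, 0 ≤ P x y) (hP1 : ∀ x, HasSum (P x) 1)
    (V : S → ℝ) (hV0 : ∀ x, 0 ≤ V x) (γ b : ℝ) (hγ0 : 0 ≤ γ) (hγ1 : γ ≤ 1)
    (hVs : ∀ x, Summable fun y => V y * P x y)
    (hV : ∀ x, ∑' y, V y * P x y ≤ γ * V x + b) (hb : 0 ≤ b) (n : ℕ) (x : S) :
    Summable (fun y => V y * kernelPow P n x y) ∧
      ∑' y, V y * kernelPow P n x y ≤ γ ^ n * V x + n * b := by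
  induction n with
  | zero =>
    have h : ∀ y, y ≠ x → V y * kernelPow P 0 x y = 0 := by
      intro y hy
      unfold kernelPow
      simp [Ne.symm hy]
    constructor
    · exact summable_of_ne_finset_zero (s := {x}) fun y hy => h y (by simpa using hy)
    · rw [tsum_eq_single x h]
      simp [kernelPow]
  | succ n ih =>
    have hPabs : ∀ i y, |P i y| = P i y := fun i y => abs_of_nonneg (hP0 i y)
    have hKabs : ∀ n y, |kernelPow P n x y| = kernelPow P n x y :=
      fun n y => abs_of_nonneg (kp_nonneg P hP0 n x y)
    have hk := kp_hasSum P hP0 hP1 n x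
    have e : (fun i => |kernelPow P n x i| * (γ * V i + b)) =
        fun i => γ * (V i * kernelPow P n x i) + kernelPow P n x i * b := by
      funext i
      rw [hKabs]; ring
    have hs1 := ih.1.mul_left γ
    have hs2 := hk.summable.mul_right b
    have := hop_bound (kernelPow P n x) P V (fun z => γ * V z + b) hV0
      (by simpa only [hPabs] using hVs) (by simpa only [hPabs] using hV)
      (by rw [e]; exact hs1.add hs2)
    rw [e, hs1.tsum_add hs2, tsum_mul_left, tsum_mul_right, hk.tsum_eq] at this
    have hh : ∀ y, |hop (kernelPow P n x) P y| = kernelPow P (n + 1) x y := fun y => hKabs (n + 1) y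
    simp only [hh] at this
    refine ⟨this.1, this.2.trans ?_⟩
    have h1 := mul_le_mul_of_nonneg_left ih.2 hγ0
    have h2 : γ * (n * b) ≤ 1 * (n * b) := mul_le_mul_of_nonneg_right hγ1 (by positivity)
    push_cast
    rw [pow_succ]
    linarith

theorem harris_drift (hP0 : ∀ x y, 0 ≤ P x y) (hP1 : ∀ x, HasSum (P x) 1)
    (V : S → ℝ) (hV0 : ∀ x, 0 ≤ V x) (γ b : ℝ) (hγ0 : 0 ≤ γ) (hγ1 : γ < 1) (hb : 0 < b)
    (hVs : ∀ x, Summable fun y => V y * P x y)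
    (hV : ∀ x, ∑' y, V y * P x y ≤ γ * V x + b) (o : S) (ho : V o = 0)
    (hmin : ∀ R : ℝ, ∃ ε : ℝ, 0 < ε ∧ ∀ x, V x ≤ R → ε ≤ kernelPow P 3 x o) :
    ∃ π : S → ℝ,
      (∀ x, 0 ≤ π x) ∧ (∑' x, π x = 1) ∧
      (∀ y, ∑' x, π x * P x y = π y) ∧
      ∃ ρ : ℝ, ρ ∈ Set.Ioo (0 : ℝ) 1 ∧
        ∃ C : S → ℝ, (∀ x, 0 ≤ C x) ∧
          ∀ (x : S) (n : ℕ),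
            tvDist (kernelPow P n x) π ≤ C x * ρ ^ n := by
  set g : ℝ := γ ^ 3 with hg
  have hg0 : 0 ≤ g := by positivity
  have hg1 : g < 1 := pow_lt_one₀ hγ0 hγ1 (by norm_num)
  set B : ℝ := 3 * b with hB
  have hB0 : 0 < B := by positivity
  have hK0 : ∀ x y, 0 ≤ kernelPow P 3 x y := kp_nonneg P hP0 3
  have hK1 : ∀ x, HasSum (kernelPow P 3 x) 1 := kp_hasSum P hP0 hP1 3
  have hKV : ∀ x, Summable (fun y => V y * kernelPow P 3 x y) ∧
      ∑' y, V y * kernelPow P 3 x y ≤ g * V x + B := fun x => by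
    simpa using kp_drift P hP0 hP1 V hV0 γ b hγ0 hγ1.le hVs hV hb.le 3 x
  set R : ℝ := 16 * B / (1 - g) with hR
  obtain ⟨ε, hε0, hε⟩ := hmin R
  have hR0 : 0 ≤ R := div_nonneg (by positivity) (by linarith)
  have hRg : R * (1 - g) = 16 * B := by rw [hR]; field_simp [show (1 - g) ≠ 0 by linarith]
  set β : ℝ := ε / (4 * B) with hβ
  have hβ0 : 0 < β := by positivity
  have hβB : β * B = ε / 4 := by rw [hβ]; field_simp
  set w : S → ℝ := fun y => 1 + β * V y with hw
  have hw1 : ∀ y, 1 ≤ w y := fun y => by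
    have := mul_nonneg hβ0.le (hV0 y)
    simp only [hw]; linarith
  have hwK : ∀ (M : S → ℝ), HasSum M 1 → Summable (fun y => V y * M y) →
      HasSum (fun y => w y * M y) (1 + β * ∑' y, V y * M y) := by
    intro M h1 h2
    have := h1.add (h2.hasSum.mul_left β)
    convert this using 1
    funext y; simp only [hw]; ring
  set α : ℝ := max ((1 + g) / 2) (1 - 3 / 4 * ε) with hα
  have hαg : (1 + g) / 2 ≤ α := le_max_left _ _
  have hαε : 1 - 3 / 4 * ε ≤ α := le_max_right _ _
  have hα1 : α < 1 := max_lt (by linarith) (by linarith)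
  have hdel : ∀ y, y ≠ o → w y * (ε * (if o = y then (1 : ℝ) else 0)) = 0 := by
    intro y hy; simp [Ne.symm hy]
  have hdelS : HasSum (fun y => w y * (ε * (if o = y then (1 : ℝ) else 0))) ε := by
    have := hasSum_single o hdel
    simpa [hw, ho] using this
  have hSum : ∀ x, Summable fun y => w y * |kernelPow P 3 x y - ε * (if o = y then 1 else 0)| := by
    intro x
    refine Summable.of_nonneg_of_le (fun y => mul_nonneg (by linarith [hw1 y]) (abs_nonneg _))
      (fun y => ?_) ((hwK _ (hK1 x) (hKV x).1).summable.add hdelS.summable)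
    rw [← mul_add]
    refine mul_le_mul_of_nonneg_left ?_ (by linarith [hw1 y])
    refine (abs_sub _ _).trans (le_of_eq ?_)
    rw [abs_of_nonneg (hK0 x y), abs_of_nonneg]
    split_ifs <;> simp [hε0.le]
  refine harris_core P hP0 hP1 w hw1 (1 + β * b) (by nlinarith) (fun x => ?_) (fun x => ?_) o ε α
    (by linarith) hα1 hSum (fun x => ?_)
  · exact (hwK _ (hP1 x) (hVs x)).summable
  · rw [(hwK _ (hP1 x) (hVs x)).tsum_eq]
    have h1 := mul_le_mul_of_nonneg_left (hV x) hβ0.le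
    have h2 : γ * V x ≤ 1 * V x := mul_le_mul_of_nonneg_right hγ1.le (hV0 x)
    have h3 := mul_le_mul_of_nonneg_left h2 hβ0.le
    have h4 : 0 ≤ β * b * (β * V x) := mul_nonneg (by positivity) (mul_nonneg hβ0.le (hV0 x))
    simp only [hw]
    nlinarith
  · have hbase := hwK _ (hK1 x) (hKV x).1
    have hm := mul_le_mul_of_nonneg_left (hKV x).2 hβ0.le
    have hVx := hV0 x
    have hβV := mul_nonneg hβ0.le hVx
    by_cases hx : V x ≤ R
    · have hh := hbase.sub hdelS
      have : ∀ y, w y * |kernelPow P 3 x y - ε * (if o = y then 1 else 0)| =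
          w y * kernelPow P 3 x y - w y * (ε * (if o = y then 1 else 0)) := by
        intro y
        rw [← mul_sub, abs_of_nonneg]
        by_cases hy : o = y
        · subst hy
          simpa using hε x hx
        · simpa [hy] using hK0 x y
      simp only [this]
      rw [hh.tsum_eq]
      simp only [hw]
      have h5 : g * (β * V x) ≤ α * (β * V x) := mul_le_mul_of_nonneg_right (by linarith) hβV
      nlinarith
    · have hh := hbase.add hdelS
      have : ∀ y, w y * |kernelPow P 3 x y - ε * (if o = y then 1 else 0)| ≤
          w y * kernelPow P 3 x y + w y * (ε * (if o = y then 1 else 0)) := by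
        intro y
        rw [← mul_add]
        refine mul_le_mul_of_nonneg_left ?_ (by linarith [hw1 y])
        refine (abs_sub _ _).trans (le_of_eq ?_)
        rw [abs_of_nonneg (hK0 x y), abs_of_nonneg]
        split_ifs <;> simp [hε0.le]
      refine (Summable.tsum_le_tsum this (hSum x) hh.summable).trans ?_
      rw [hh.tsum_eq]
      simp only [hw]
      have h5 : (1 + g) / 2 * (β * V x) ≤ α * (β * V x) := mul_le_mul_of_nonneg_right hαg hβV
      have h6 : β * (R * (1 - g)) ≤ β * (V x * (1 - g)) :=
        mul_le_mul_of_nonneg_left (mul_le_mul_of_nonneg_right (not_le.1 hx).le (by linarith)) hβ0.le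
      rw [hRg] at h6
      nlinarith

end harris3

section det

open Polynomial

/-- Polynomials with nonnegative coefficients. -/
def NNPoly (p : ℝ[X]) : Prop := ∀ n, 0 ≤ p.coeff n

lemma NNPoly.mul {p q : ℝ[X]} (hp : NNPoly p) (hq : NNPoly q) : NNPoly (p * q) := by
  intro n
  rw [coeff_mul]
  exact Finset.sum_nonneg fun x _ => mul_nonneg (hp _) (hq _)

lemma NNPoly.expand {p : ℝ[X]} (hp : NNPoly p) : NNPoly (Polynomial.expand ℝ 2 p) := by
  intro n
  rw [coeff_expand (by norm_num)]
  split_ifs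
  · exact hp _
  · exact le_rfl

lemma nnpoly_quad {p q : ℝ} (hp : 0 ≤ p) (hq : 0 ≤ q) : NNPoly (X ^ 2 + C p * X + C q) := by
  intro n
  simp only [coeff_add, coeff_X_pow, coeff_C_mul, coeff_X, coeff_C]
  split_ifs <;> simp <;> positivity

lemma nnpoly_one : NNPoly (1 : ℝ[X]) := by
  intro n
  rw [coeff_one]
  split_ifs <;> simp

lemma quad_ne {p q : ℝ} : (X ^ 2 + C p * X + C q : ℝ[X]) ≠ 0 := by
  intro h
  have := congrArg (fun f => coeff f 2) h
  simp at this

lemma quad_nn (n : ℕ) : ∀ p q : ℝ, 0 < q → 4 * q ≤ 2 ^ n * (4 * q - p ^ 2) →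
    ∃ Q : ℝ[X], Q ≠ 0 ∧ NNPoly Q ∧ NNPoly (Q * (X ^ 2 - C p * X + C q)) := by
  induction n with
  | zero =>
    intro p q hq h
    have hp : p = 0 := by
      have : p ^ 2 ≤ 0 := by linarith
      exact pow_eq_zero_iff (two_ne_zero) |>.1 (le_antisymm this (sq_nonneg p))
    refine ⟨1, one_ne_zero, nnpoly_one, ?_⟩
    have := nnpoly_quad (p := 0) le_rfl hq.le
    subst hp
    simpa using this
  | succ n ih =>
    intro p q hq h
    by_cases hp : p ≤ 0
    · refine ⟨1, one_ne_zero, nnpoly_one, ?_⟩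
      have := nnpoly_quad (p := -p) (by linarith) hq.le
      simpa [sub_eq_add_neg] using this
    have hp : 0 < p := not_le.1 hp
    have key : (X ^ 2 + C p * X + C q) * (X ^ 2 - C p * X + C q) =
        Polynomial.expand ℝ 2 (X ^ 2 - C (p ^ 2 - 2 * q) * X + C (q ^ 2)) := by
      simp only [map_add, map_sub, map_mul, map_pow, expand_X, expand_C]
      have : (C (2 : ℝ)) = (2 : ℝ[X]) := rfl
      rw [this]
      ring
    by_cases h2 : p ^ 2 ≤ 2 * q
    · refine ⟨X ^ 2 + C p * X + C q, quad_ne, nnpoly_quad hp.le hq.le, ?_⟩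
      rw [key]
      apply NNPoly.expand
      have := nnpoly_quad (p := -(p ^ 2 - 2 * q)) (q := q ^ 2) (by linarith) (by positivity)
      rw [C_neg, neg_mul, ← sub_eq_add_neg] at this
      exact this
    · have h2 : 2 * q < p ^ 2 := not_le.1 h2
      obtain ⟨Q, hQ0, hQ, hQQ⟩ := ih (p ^ 2 - 2 * q) (q ^ 2) (by positivity) (by
        have e : 4 * q ^ 2 - (p ^ 2 - 2 * q) ^ 2 = p ^ 2 * (4 * q - p ^ 2) := by ring
        rw [e]
        have hpos : 0 < 2 ^ (n + 1) * (4 * q - p ^ 2) := by linarith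
        have hpos' : 0 < 4 * q - p ^ 2 := by
          exact (pos_iff_pos_of_mul_pos hpos).1 (by positivity)
        have h3 : 2 ^ n * (2 * q * (4 * q - p ^ 2)) ≤ 2 ^ n * (p ^ 2 * (4 * q - p ^ 2)) := by
          gcongr
        refine le_trans ?_ h3
        have h4 := mul_le_mul_of_nonneg_left h hq.le
        rw [pow_succ] at h4
        linarith)
      refine ⟨Polynomial.expand ℝ 2 Q * (X ^ 2 + C p * X + C q), mul_ne_zero ?_ quad_ne,
        hQ.expand.mul (nnpoly_quad hp.le hq.le), ?_⟩
      · rwa [Ne, expand_eq_zero (by norm_num)]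
      · rw [mul_assoc, key, ← map_mul]
        exact hQQ.expand

lemma cubic_nn (a b c : ℝ) (hc : c < 0) (hb : b < 0)
    (hdisc : a ^ 2 * b ^ 2 + 4 * b ^ 3 - 4 * a ^ 3 * c - 18 * a * b * c - 27 * c ^ 2 < 0) :
    ∃ Q : ℝ[X], Q ≠ 0 ∧ NNPoly (Q * (X ^ 3 - C a * X ^ 2 - C b * X - C c)) := by
  set f : ℝ → ℝ := fun x => x ^ 3 - a * x ^ 2 - b * x - c with hf
  have hfc : Continuous f := by rw [hf]; fun_prop
  set M : ℝ := 1 + |a| + |c| with hM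
  have hM0 : 1 ≤ M := by rw [hM]; linarith [abs_nonneg a, abs_nonneg c]
  have hfM : f (-M) ≤ 0 := by
    have h1 : -a * M ^ 2 ≤ |a| * M ^ 2 :=
      mul_le_mul_of_nonneg_right (neg_le_abs a) (by positivity)
    have h2 : -c ≤ |c| := neg_le_abs c
    have h3 : M ^ 3 = M ^ 2 + |a| * M ^ 2 + |c| * M ^ 2 := by rw [hM]; ring
    have h4 : |c| * 1 ≤ |c| * M ^ 2 :=
      mul_le_mul_of_nonneg_left (one_le_pow₀ hM0) (abs_nonneg _)
    have h5 : b * M ≤ 0 := mul_nonpos_of_nonpos_of_nonneg hb.le (by linarith)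
    have h6 := sq_nonneg M
    simp only [hf]
    nlinarith
  have hf0 : 0 < f 0 := by simp [hf]; exact hc
  obtain ⟨x, hx, hfx⟩ := intermediate_value_Icc (by linarith : -M ≤ 0) hfc.continuousOn
    ⟨hfM, hf0.le⟩
  have hx0 : x ≠ 0 := by rintro rfl; linarith
  have hxneg : x < 0 := lt_of_le_of_ne hx.2 hx0
  obtain ⟨r, rfl⟩ : ∃ r, x = -r := ⟨-x, by ring⟩
  have hr : 0 < r := by linarith
  obtain ⟨p, hp⟩ : ∃ p, p = a + r := ⟨_, rfl⟩
  obtain ⟨q, hq⟩ : ∃ q, q = r * p - b := ⟨_, rfl⟩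
  have ha : a = p - r := by linarith
  have hb' : b = r * p - q := by linarith
  have hcq : c = - (r * q) := by
    simp only [hf] at hfx
    rw [ha, hb'] at hfx
    linarith
  have hq0 : 0 < q := by
    have : 0 < r * q := by linarith
    exact (pos_iff_pos_of_mul_pos this).1 hr
  have hpq : 0 < 4 * q - p ^ 2 := by
    have e : a ^ 2 * b ^ 2 + 4 * b ^ 3 - 4 * a ^ 3 * c - 18 * a * b * c - 27 * c ^ 2 =
        (p ^ 2 - 4 * q) * (r ^ 2 + p * r + q) ^ 2 := by
      rw [ha, hb', hcq]; ring
    rw [e] at hdisc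
    by_contra hcon
    have : 0 ≤ (p ^ 2 - 4 * q) * (r ^ 2 + p * r + q) ^ 2 :=
      mul_nonneg (by linarith) (sq_nonneg _)
    linarith
  obtain ⟨n, hn⟩ := pow_unbounded_of_one_lt (4 * q / (4 * q - p ^ 2)) (one_lt_two (α := ℝ))
  rw [div_lt_iff₀ hpq] at hn
  obtain ⟨Q, hQ0, -, hQ⟩ := quad_nn n p q hq0 hn.le
  refine ⟨Q, hQ0, ?_⟩
  have e : Q * (X ^ 3 - C a * X ^ 2 - C b * X - C c) =
      Q * (X ^ 2 - C p * X + C q) * (X + C r) := by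
    rw [ha, hb', hcq]
    simp only [C_sub, C_mul, C_neg]
    ring
  rw [e]
  refine hQ.mul ?_
  intro n
  simp only [coeff_add, coeff_X, coeff_C]
  split_ifs <;> positivity

lemma traj_zero (a b c : ℝ) (hc : c < 0) (hb : b < 0)
    (hdisc : a ^ 2 * b ^ 2 + 4 * b ^ 3 - 4 * a ^ 3 * c - 18 * a * b * c - 27 * c ^ 2 < 0) :
    ∃ m : ℕ, ∀ u : ℕ → ℝ, (∀ n, 0 ≤ u n) →
      (∀ n, u (n + 3) = max (a * u (n + 2) + b * u (n + 1) + c * u n) 0) →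
      ∃ n ≤ m, u (n + 3) = 0 := by
  obtain ⟨Q, hQ0, hQ⟩ := cubic_nn a b c hc hb hdisc
  refine ⟨Q.natDegree, fun u hu hrec => ?_⟩
  by_contra! hcon
  have hlin : ∀ n ≤ Q.natDegree, u (n + 3) = a * u (n + 2) + b * u (n + 1) + c * u n := by
    intro n hn
    have h1 := hcon n hn
    rw [hrec n] at h1 ⊢
    rcases max_choice (a * u (n + 2) + b * u (n + 1) + c * u n) 0 with h | h
    · exact h
    · exact absurd h h1
  set Λ : ℝ[X] →ₗ[ℝ] ℝ := Polynomial.lsum (fun k => (u k) • LinearMap.id) with hΛ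
  have hΛm : ∀ j r, Λ (monomial j r) = r * u j := by
    intro j r
    rw [hΛ, lsum_apply, sum_monomial_index]
    · simp [mul_comm]
    · simp
  set P0 : ℝ[X] := X ^ 3 - C a * X ^ 2 - C b * X - C c with hP0
  have hP0d : P0.natDegree = 3 := by
    rw [hP0]; compute_degree!
  have hP00 : P0 ≠ 0 := by
    intro h; rw [h] at hP0d; simp at hP0d
  have hterm : ∀ n ≤ Q.natDegree, ∀ r, Λ (monomial n r * P0) = 0 := by
    intro n hn r
    have e : monomial n r * P0 = monomial (n + 3) r - monomial (n + 2) (r * a) -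
        monomial (n + 1) (r * b) - monomial n (r * c) := by
      rw [hP0]
      simp only [← C_mul_X_pow_eq_monomial, C_mul]
      ring
    rw [e]
    simp only [map_sub, hΛm]
    rw [hlin n hn]
    ring
  have hzero : Λ (Q * P0) = 0 := by
    conv_lhs => rw [Q.as_sum_range]
    rw [Finset.sum_mul, map_sum]
    refine Finset.sum_eq_zero fun n hn => hterm n ?_ _
    have := Finset.mem_range.1 hn
    omega
  have hne : Q * P0 ≠ 0 := mul_ne_zero hQ0 hP00
  have hdeg : (Q * P0).natDegree = Q.natDegree + 3 := by
    rw [natDegree_mul hQ0 hP00, hP0d]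
  have hpos : 0 < Λ (Q * P0) := by
    rw [hΛ, lsum_apply, Polynomial.sum]
    simp only [LinearMap.smul_apply, LinearMap.id_apply, smul_eq_mul]
    refine Finset.sum_pos' (fun k _ => mul_nonneg (hu k) (hQ k)) ⟨Q.natDegree + 3, ?_, ?_⟩
    · rw [← hdeg]; exact natDegree_mem_support_of_nonzero hne
    · refine mul_pos (lt_of_le_of_ne (hu _) (Ne.symm (hcon _ le_rfl))) ?_
      refine lt_of_le_of_ne (hQ _) ?_
      rw [← hdeg]
      exact Ne.symm (leadingCoeff_ne_zero.2 hne)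
  linarith

end det

/-- The deterministic skeleton. -/
noncomputable def detT (a b c : ℝ) (x : ℝ × ℝ × ℝ) : ℝ × ℝ × ℝ :=
  (max (a * x.1 + b * x.2.1 + c * x.2.2) 0, x.1, x.2.1)

/-- The `ℓ¹` norm on `ℝ³`. -/
noncomputable def qn (x : ℝ × ℝ × ℝ) : ℝ := |x.1| + |x.2.1| + |x.2.2|

/-- The `ℓ¹` distance on `ℝ³`. -/
noncomputable def qd (x y : ℝ × ℝ × ℝ) : ℝ :=
  |x.1 - y.1| + |x.2.1 - y.2.1| + |x.2.2 - y.2.2|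

lemma detT_lip (a b c : ℝ) (x y : ℝ × ℝ × ℝ) :
    qd (detT a b c x) (detT a b c y) ≤ (1 + |a| + |b| + |c|) * qd x y := by
  have h1 : |max (a * x.1 + b * x.2.1 + c * x.2.2) 0 - max (a * y.1 + b * y.2.1 + c * y.2.2) 0| ≤
      |a| * |x.1 - y.1| + |b| * |x.2.1 - y.2.1| + |c| * |x.2.2 - y.2.2| := by
    refine (abs_max_sub_max_le_abs _ _ _).trans ?_
    have e : a * x.1 + b * x.2.1 + c * x.2.2 - (a * y.1 + b * y.2.1 + c * y.2.2) =
      a * (x.1 - y.1) + b * (x.2.1 - y.2.1) + c * (x.2.2 - y.2.2) := by ring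
    rw [e, ← abs_mul, ← abs_mul, ← abs_mul]
    exact abs_add_three _ _ _
  unfold qd detT
  simp only
  have ha := abs_nonneg a
  have hb := abs_nonneg b
  have hc := abs_nonneg c
  have hx := abs_nonneg (x.1 - y.1)
  have hy := abs_nonneg (x.2.1 - y.2.1)
  have hz := abs_nonneg (x.2.2 - y.2.2)
  nlinarith [mul_nonneg ha hy, mul_nonneg ha hz, mul_nonneg hb hx, mul_nonneg hb hz,
    mul_nonneg hc hx, mul_nonneg hc hy]

lemma detT_iter_lip (a b c : ℝ) (n : ℕ) (x y : ℝ × ℝ × ℝ) :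
    qd ((detT a b c)^[n] x) ((detT a b c)^[n] y) ≤ (1 + |a| + |b| + |c|) ^ n * qd x y := by
  induction n with
  | zero => simp
  | succ n ih =>
    rw [Function.iterate_succ_apply', Function.iterate_succ_apply', pow_succ', mul_assoc]
    exact (detT_lip a b c _ _).trans (mul_le_mul_of_nonneg_left ih (by positivity))

lemma qn_le_qd (x y : ℝ × ℝ × ℝ) : qn x ≤ qn y + qd x y := by
  unfold qn qd
  have h1 := abs_sub_abs_le_abs_sub x.1 y.1
  have h2 := abs_sub_abs_le_abs_sub x.2.1 y.2.1
  have h3 := abs_sub_abs_le_abs_sub x.2.2 y.2.2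
  linarith

lemma detT_nilp (a b c : ℝ) (hc : c < 0) (hb : b < 0)
    (hdisc : a ^ 2 * b ^ 2 + 4 * b ^ 3 - 4 * a ^ 3 * c - 18 * a * b * c - 27 * c ^ 2 < 0) :
    ∃ N : ℕ, ∀ x : ℝ × ℝ × ℝ, 0 ≤ x.1 → 0 ≤ x.2.1 → 0 ≤ x.2.2 → (detT a b c)^[N] x = (0, 0, 0) := by
  obtain ⟨m, hm⟩ := traj_zero a b c hc hb hdisc
  refine ⟨m + 3, fun x h1 h2 h3 => ?_⟩
  set T := detT a b c with hT
  set u : ℕ → ℝ := fun n => (T^[n] x).2.2 with hu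
  have e1 : ∀ n, (T^[n] x).2.1 = u (n + 1) := by
    intro n
    simp only [hu, Function.iterate_succ_apply', hT, detT]
  have e2 : ∀ n, (T^[n] x).1 = u (n + 2) := by
    intro n
    rw [← e1 (n + 1)]
    simp only [Function.iterate_succ_apply', hT, detT]
  have hrec : ∀ n, u (n + 3) = max (a * u (n + 2) + b * u (n + 1) + c * u n) 0 := by
    intro n
    rw [← e2 (n + 1), ← e2 n, ← e1 n]
    simp only [hu, Function.iterate_succ_apply', hT, detT]
  have hu0 : ∀ n, 0 ≤ u n := by
    intro n
    match n with
    | 0 => exact h3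
    | 1 => rw [← e1 0]; exact h2
    | 2 => rw [← e2 0]; exact h1
    | k + 3 => rw [hrec]; exact le_max_right _ _
  obtain ⟨n, hn, hn0⟩ := hm u hu0 hrec
  have h4 : u (n + 4) = 0 := by
    rw [hrec (n + 1), hn0]
    refine max_eq_right ?_
    have := mul_nonneg_of_nonpos_of_nonpos hb.le (neg_nonpos.2 (hu0 (n + 2)))
    have := mul_nonneg_of_nonpos_of_nonpos hc.le (neg_nonpos.2 (hu0 (n + 1)))
    linarith
  have h5 : u (n + 5) = 0 := by
    rw [hrec (n + 2), h4, hn0]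
    refine max_eq_right ?_
    have := mul_nonneg_of_nonpos_of_nonpos hc.le (neg_nonpos.2 (hu0 (n + 2)))
    linarith
  have h6 : ∀ k, u (n + 3 + k) = 0 ∧ u (n + 4 + k) = 0 ∧ u (n + 5 + k) = 0 := by
    intro k
    induction k with
    | zero => exact ⟨hn0, h4, h5⟩
    | succ k ih =>
      refine ⟨?_, ?_, ?_⟩
      · rw [show n + 3 + (k + 1) = n + 4 + k by ring]; exact ih.2.1
      · rw [show n + 4 + (k + 1) = n + 5 + k by ring]; exact ih.2.2
      · rw [show n + 5 + (k + 1) = (n + 3 + k) + 3 by ring, hrec,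
          show n + 3 + k + 2 = n + 5 + k by ring, show n + 3 + k + 1 = n + 4 + k by ring,
          ih.1, ih.2.1, ih.2.2]
        simp
  obtain ⟨k, rfl⟩ : ∃ k, m = n + k := ⟨m - n, by omega⟩
  have h7 := h6 k
  refine Prod.ext ?_ (Prod.ext ?_ ?_)
  · rw [e2]; rw [show n + k + 3 + 2 = n + 5 + k by ring]; exact h7.2.2
  · rw [e1]; rw [show n + k + 3 + 1 = n + 4 + k by ring]; exact h7.2.1
  · change u (n + k + 3) = 0
    rw [show n + k + 3 = n + 3 + k by ring]; exact h7.1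

lemma HasSum.congr_fun' {ι : Type*} {f g : ι → ℝ} {v : ℝ} (h : HasSum f v) (hfg : ∀ i, g i = f i) :
    HasSum g v := by
  rwa [show g = f from funext hfg]

lemma pois_nonneg {s : ℝ} (hs : 0 ≤ s) (k : ℕ) : 0 ≤ poissonPMF s k := by
  unfold poissonPMF; positivity

lemma pois_sum {s : ℝ} (hs : 0 ≤ s) : HasSum (poissonPMF s) 1 :=
  ProbabilityTheory.hasSum_one_poissonMeasure ⟨s, hs⟩

lemma pois_succ (s : ℝ) (k : ℕ) : ((k + 1 : ℕ) : ℝ) * poissonPMF s (k + 1) = s * poissonPMF s k := by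
  unfold poissonPMF
  rw [Nat.factorial_succ]
  push_cast
  have h1 : ((k : ℝ) + 1) ≠ 0 := by positivity
  have h2 : (Nat.factorial k : ℝ) ≠ 0 := by positivity
  field_simp
  ring

lemma pois_mean {s : ℝ} (hs : 0 ≤ s) : HasSum (fun k : ℕ => (k : ℝ) * poissonPMF s k) s := by
  have h := (hasSum_nat_add_iff (f := fun k : ℕ => (k : ℝ) * poissonPMF s k) (g := s) 1).1 (by
    simp only [pois_succ]
    simpa using (pois_sum hs).mul_left s)
  simpa using h

lemma pois_sq {s : ℝ} (hs : 0 ≤ s) :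
    HasSum (fun k : ℕ => (k : ℝ) ^ 2 * poissonPMF s k) (s * (s + 1)) := by
  have h := (hasSum_nat_add_iff (f := fun k : ℕ => (k : ℝ) ^ 2 * poissonPMF s k)
    (g := s * (s + 1)) 1).1 (by
    have e : ∀ k : ℕ, ((k + 1 : ℕ) : ℝ) ^ 2 * poissonPMF s (k + 1) =
        s * ((k : ℝ) * poissonPMF s k + poissonPMF s k) := by
      intro k
      rw [sq, mul_assoc, pois_succ]
      push_cast
      ring
    simp only [e]
    exact ((pois_mean hs).add (pois_sum hs)).mul_left s)
  simpa using h

lemma pois_var {s : ℝ} (hs : 0 ≤ s) :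
    HasSum (fun k : ℕ => ((k : ℝ) - s) ^ 2 * poissonPMF s k) s := by
  have h := ((pois_sq hs).sub ((pois_mean hs).mul_left (2 * s))).add ((pois_sum hs).mul_left (s ^ 2))
  rw [show s * (s + 1) - 2 * s * s + s ^ 2 * 1 = s by ring] at h
  refine h.congr_fun' fun k => ?_
  ring

/-- Lyapunov function on `ℝ³`. -/
noncomputable def lyapR (a b c : ℝ) (N : ℕ) (x : ℝ × ℝ × ℝ) : ℝ :=
  ∑ n ∈ Finset.range N, 2 ^ n * qn ((detT a b c)^[n] x)

/-- The embedding of the state space. -/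
noncomputable def emb3 (x : ℕ × ℕ × ℕ) : ℝ × ℝ × ℝ := (x.1, x.2.1, x.2.2)

lemma qn_nonneg (x : ℝ × ℝ × ℝ) : 0 ≤ qn x := by unfold qn; positivity

lemma lyapR_nonneg (a b c : ℝ) (N : ℕ) (x : ℝ × ℝ × ℝ) : 0 ≤ lyapR a b c N x :=
  Finset.sum_nonneg fun n _ => mul_nonneg (by positivity) (qn_nonneg _)

lemma lyapR_lip (a b c : ℝ) (N : ℕ) (x y : ℝ × ℝ × ℝ) :
    lyapR a b c N x ≤ lyapR a b c N y +
      (∑ n ∈ Finset.range N, 2 ^ n * (1 + |a| + |b| + |c|) ^ n) * qd x y := by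
  unfold lyapR
  rw [Finset.sum_mul, ← Finset.sum_add_distrib]
  refine Finset.sum_le_sum fun n _ => ?_
  rw [mul_assoc, ← mul_add]
  refine mul_le_mul_of_nonneg_left ?_ (by positivity)
  exact (qn_le_qd _ _).trans (add_le_add le_rfl (detT_iter_lip a b c n x y))

lemma lyapR_contr (a b c : ℝ) (N : ℕ) (x : ℝ × ℝ × ℝ) (h : (detT a b c)^[N] x = (0, 0, 0)) :
    lyapR a b c N (detT a b c x) ≤ 1 / 2 * lyapR a b c N x := by
  unfold lyapR
  have h1 : ∑ n ∈ Finset.range N, 2 ^ n * qn ((detT a b c)^[n] (detT a b c x)) =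
      1 / 2 * ∑ n ∈ Finset.range N, 2 ^ (n + 1) * qn ((detT a b c)^[n + 1] x) := by
    rw [Finset.mul_sum]
    refine Finset.sum_congr rfl fun n _ => ?_
    rw [Function.iterate_succ_apply, pow_succ]
    ring
  rw [h1]
  have h2 := Finset.sum_range_succ' (fun n => 2 ^ n * qn ((detT a b c)^[n] x)) N
  rw [Finset.sum_range_succ, h] at h2
  have h3 := qn_nonneg x
  have h4 : qn (0, 0, 0) = 0 := by simp [qn]
  simp only [h4, pow_zero, Function.iterate_zero, id_eq] at h2
  linarith

lemma row_hasSum (a b c lam : ℝ) (x : ℕ × ℕ × ℕ) (F : ℕ × ℕ × ℕ → ℝ) (v : ℝ)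
    (h : HasSum (fun l : ℕ => F (l, x.1, x.2.1) * poissonPMF (s3 a b c lam x) l) v) :
    HasSum (fun y => F y * hawkes3P a b c lam x y) v := by
  have hinj : Function.Injective (fun l : ℕ => ((l, x.1, x.2.1) : ℕ × ℕ × ℕ)) := by
    intro l l' hl
    simpa using hl
  refine (hinj.hasSum_iff ?_).1 ?_
  · intro y hy
    have : ¬ (y.2.1 = x.1 ∧ y.2.2 = x.2.1) := by
      rintro ⟨h1, h2⟩
      exact hy ⟨y.1, by rw [← h1, ← h2]⟩
    simp [hawkes3P, this]
  · convert h using 1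
    funext l
    simp [hawkes3P]

lemma s3_nonneg (a b c lam : ℝ) (x : ℕ × ℕ × ℕ) : 0 ≤ s3 a b c lam x := le_max_right _ _

lemma s3_le (a b c lam : ℝ) (hlam : 0 < lam) (x : ℕ × ℕ × ℕ) :
    s3 a b c lam x ≤ lam + (|a| + |b| + |c|) * qn (emb3 x) := by
  have e : qn (emb3 x) = (x.1 : ℝ) + x.2.1 + x.2.2 := by simp [qn, emb3]
  rw [e]
  have hi : (0 : ℝ) ≤ x.1 := Nat.cast_nonneg _
  have hj : (0 : ℝ) ≤ x.2.1 := Nat.cast_nonneg _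
  have hk : (0 : ℝ) ≤ x.2.2 := Nat.cast_nonneg _
  have ha := abs_nonneg a
  have hb := abs_nonneg b
  have hc := abs_nonneg c
  unfold s3
  refine max_le ?_ (by positivity)
  nlinarith [mul_le_mul_of_nonneg_right (le_abs_self a) hi,
    mul_le_mul_of_nonneg_right (le_abs_self b) hj, mul_le_mul_of_nonneg_right (le_abs_self c) hk,
    mul_nonneg ha hj, mul_nonneg ha hk, mul_nonneg hb hi, mul_nonneg hb hk, mul_nonneg hc hi,
    mul_nonneg hc hj]

lemma hawkes_nonneg (a b c lam : ℝ) (x y : ℕ × ℕ × ℕ) : 0 ≤ hawkes3P a b c lam x y := by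
  unfold hawkes3P
  split_ifs
  · exact pois_nonneg (s3_nonneg _ _ _ _ _) _
  · exact le_rfl

lemma hawkes_sum (a b c lam : ℝ) (x : ℕ × ℕ × ℕ) : HasSum (hawkes3P a b c lam x) 1 := by
  have := row_hasSum a b c lam x (fun _ => 1) 1 (by
    simpa using pois_sum (s3_nonneg a b c lam x))
  simpa using this

lemma hawkes_drift (a b c lam : ℝ) (hlam : 0 < lam) (N : ℕ) (δ : ℝ) (hδ : 0 < δ) (x : ℕ × ℕ × ℕ)
    (L : ℝ) (hL : L = ∑ n ∈ Finset.range N, 2 ^ n * (1 + |a| + |b| + |c|) ^ n) :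
    Summable (fun y => lyapR a b c N (emb3 y) * hawkes3P a b c lam x y) ∧
    ∑' y, lyapR a b c N (emb3 y) * hawkes3P a b c lam x y ≤
      lyapR a b c N (detT a b c (emb3 x)) + L * (lam + δ * s3 a b c lam x + 1 / (4 * δ)) := by
  have hL0 : 0 ≤ L := by rw [hL]; positivity
  set s := s3 a b c lam x with hs
  have hs0 : 0 ≤ s := s3_nonneg _ _ _ _ _
  set W := lyapR a b c N (detT a b c (emb3 x)) with hW
  have hbound : ∀ l : ℕ, lyapR a b c N (emb3 (l, x.1, x.2.1)) ≤
      W + L * (lam + δ * ((l : ℝ) - s) ^ 2 + 1 / (4 * δ)) := by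
    intro l
    refine (lyapR_lip a b c N _ (detT a b c (emb3 x))).trans ?_
    rw [← hL]
    refine add_le_add le_rfl (mul_le_mul_of_nonneg_left ?_ hL0)
    set t := max (a * (x.1 : ℝ) + b * x.2.1 + c * x.2.2) 0 with ht
    have e : qd (emb3 (l, x.1, x.2.1)) (detT a b c (emb3 x)) = |(l : ℝ) - t| := by
      simp [qd, emb3, detT, ht]
    rw [e]
    have h1 : |s - t| ≤ lam := by
      have := abs_max_sub_max_le_abs (a * (x.1 : ℝ) + b * x.2.1 + c * x.2.2 + lam)
        (a * (x.1 : ℝ) + b * x.2.1 + c * x.2.2) 0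
      rw [add_sub_cancel_left, abs_of_pos hlam] at this
      exact this
    have h2 : |(l : ℝ) - t| ≤ |(l : ℝ) - s| + |s - t| := abs_sub_le _ _ _
    have h3 : |(l : ℝ) - s| ≤ δ * ((l : ℝ) - s) ^ 2 + 1 / (4 * δ) := by
      rw [← sq_abs ((l : ℝ) - s)]
      set z := |(l : ℝ) - s|
      have : δ * z ^ 2 + 1 / (4 * δ) - z = (2 * δ * z - 1) ^ 2 / (4 * δ) := by
        field_simp; ring
      have h4 : 0 ≤ (2 * δ * z - 1) ^ 2 / (4 * δ) := by positivity
      linarith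
    linarith
  have hsum : HasSum (fun l : ℕ => (W + L * (lam + δ * ((l : ℝ) - s) ^ 2 + 1 / (4 * δ))) *
      poissonPMF s l) (W + L * (lam + δ * s + 1 / (4 * δ))) := by
    have := ((pois_sum hs0).mul_left (W + L * (lam + 1 / (4 * δ)))).add
      ((pois_var hs0).mul_left (L * δ))
    rw [show (W + L * (lam + 1 / (4 * δ))) * 1 + L * δ * s =
      W + L * (lam + δ * s + 1 / (4 * δ)) by ring] at this
    refine this.congr_fun' fun l => ?_
    ring
  have hle : ∀ l : ℕ, lyapR a b c N (emb3 (l, x.1, x.2.1)) * poissonPMF s l ≤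
      (W + L * (lam + δ * ((l : ℝ) - s) ^ 2 + 1 / (4 * δ))) * poissonPMF s l := fun l =>
    mul_le_mul_of_nonneg_right (hbound l) (pois_nonneg hs0 l)
  have hsm : Summable (fun l : ℕ => lyapR a b c N (emb3 (l, x.1, x.2.1)) * poissonPMF s l) :=
    Summable.of_nonneg_of_le
      (fun l => mul_nonneg (lyapR_nonneg _ _ _ _ _) (pois_nonneg hs0 l)) hle hsum.summable
  have hrow := row_hasSum a b c lam x (fun y => lyapR a b c N (emb3 y)) _ hsm.hasSum
  refine ⟨hrow.summable, ?_⟩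
  rw [hrow.tsum_eq, ← hsum.tsum_eq]
  exact Summable.tsum_le_tsum hle hsm hsum.summable

lemma kp_step {S : Type*} (P : S → S → ℝ) (hP0 : ∀ x y, 0 ≤ P x y) (hP1 : ∀ x, HasSum (P x) 1)
    (n : ℕ) (x z y : S) : kernelPow P n x z * P z y ≤ kernelPow P (n + 1) x y := by
  have hs : Summable fun z => kernelPow P n x z * P z y := by
    refine Summable.of_nonneg_of_le (fun z => mul_nonneg (kp_nonneg P hP0 n x z) (hP0 z y))
      (fun z => ?_) (kp_hasSum P hP0 hP1 n x).summable
    refine mul_le_of_le_one_right (kp_nonneg P hP0 n x z) ?_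
    rw [← (hP1 z).tsum_eq]
    exact (hP1 z).summable.le_tsum y fun u _ => hP0 z u
  exact hs.le_tsum z fun u _ => mul_nonneg (kp_nonneg P hP0 n x u) (hP0 u y)

lemma hawkes_minor (a b c lam : ℝ) (hlam : 0 < lam) (R : ℝ) (x : ℕ × ℕ × ℕ)
    (hx : qn (emb3 x) ≤ R) :
    Real.exp (-(lam + (|a| + |b| + |c|) * R)) ^ 3 ≤
      kernelPow (hawkes3P a b c lam) 3 x (0, 0, 0) := by
  set E := Real.exp (-(lam + (|a| + |b| + |c|) * R)) with hE
  have hE0 : 0 ≤ E := (Real.exp_pos _).le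
  have hstep : ∀ z : ℕ × ℕ × ℕ, qn (emb3 z) ≤ R →
      E ≤ hawkes3P a b c lam z (0, z.1, z.2.1) := by
    intro z hz
    have : hawkes3P a b c lam z (0, z.1, z.2.1) = Real.exp (-(s3 a b c lam z)) := by
      simp [hawkes3P, poissonPMF]
    rw [this, hE]
    refine Real.exp_le_exp.2 (neg_le_neg ((s3_le a b c lam hlam z).trans ?_))
    have := mul_le_mul_of_nonneg_left hz (a := |a| + |b| + |c|) (by positivity)
    linarith
  have hi : (0 : ℝ) ≤ x.1 := Nat.cast_nonneg _
  have hj : (0 : ℝ) ≤ x.2.1 := Nat.cast_nonneg _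
  have hk : (0 : ℝ) ≤ x.2.2 := Nat.cast_nonneg _
  have hx' : (x.1 : ℝ) + x.2.1 + x.2.2 ≤ R := by simpa [qn, emb3] using hx
  have hP0 := hawkes_nonneg a b c lam
  have hP1 := hawkes_sum a b c lam
  have h0 : kernelPow (hawkes3P a b c lam) 0 x x = 1 := by simp [kernelPow]
  have s1 := kp_step _ hP0 hP1 0 x x (0, x.1, x.2.1)
  have s2 := kp_step _ hP0 hP1 1 x (0, x.1, x.2.1) (0, 0, x.1)
  have s3' := kp_step _ hP0 hP1 2 x (0, 0, x.1) (0, 0, 0)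
  have t1 := hstep x hx
  have t2 := hstep (0, x.1, x.2.1) (by simp [qn, emb3]; linarith)
  have t3 := hstep (0, 0, x.1) (by simp [qn, emb3]; linarith)
  rw [h0, one_mul] at s1
  have r1 : E ≤ kernelPow (hawkes3P a b c lam) 1 x (0, x.1, x.2.1) := t1.trans s1
  have r2 : E * E ≤ kernelPow (hawkes3P a b c lam) 2 x (0, 0, x.1) :=
    (mul_le_mul r1 t2 hE0 (hE0.trans r1)).trans s2
  have r3 := (mul_le_mul r2 t3 hE0 ((mul_nonneg hE0 hE0).trans r2)).trans s3'
  calc E ^ 3 = E * E * E := by ring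
    _ ≤ _ := r3

/-- If `b < 0`, `c < 0` and `Disc(P) = a²b² + 4b³ − 4a³c − 18abc − 27c² < 0`, then the
discrete-time Hawkes chain with memory `3` and parameters `(a,b,c,λ)` is geometrically
ergodic: there is an invariant probability measure `π`, a rate `ρ ∈ (0,1)` and a constant
`C(x) ≥ 0` such that the `n`-step law from `x` is within total variation distance
`C(x) ρ^n` of `π`. -/
theorem hawkes3_geometrically_ergodic (a b c lam : ℝ) (hlam : 0 < lam)
    (hb : b < 0) (hc : c < 0)
    (hdisc : a ^ 2 * b ^ 2 + 4 * b ^ 3 - 4 * a ^ 3 * c - 18 * a * b * c - 27 * c ^ 2 < 0) :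
    ∃ π : ℕ × ℕ × ℕ → ℝ,
      (∀ x, 0 ≤ π x) ∧ (∑' x, π x = 1) ∧
      (∀ y, ∑' x, π x * hawkes3P a b c lam x y = π y) ∧
      ∃ ρ : ℝ, ρ ∈ Set.Ioo (0 : ℝ) 1 ∧
        ∃ C : ℕ × ℕ × ℕ → ℝ, (∀ x, 0 ≤ C x) ∧
          ∀ (x : ℕ × ℕ × ℕ) (n : ℕ),
            tvDist (kernelPow (hawkes3P a b c lam) n x) π ≤ C x * ρ ^ n := by
  obtain ⟨N0, hN0⟩ := detT_nilp a b c hc hb hdisc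
  set N := N0 + 1 with hN
  set V : ℕ × ℕ × ℕ → ℝ := fun x => lyapR a b c N (emb3 x) with hV
  set L : ℝ := ∑ n ∈ Finset.range N, 2 ^ n * (1 + |a| + |b| + |c|) ^ n with hL
  have hL0 : 0 ≤ L := by rw [hL]; positivity
  set A : ℝ := |a| + |b| + |c| with hA
  have hA0 : 0 ≤ A := by positivity
  set δ : ℝ := 1 / (4 * (L * A + 1)) with hδ
  have hδ0 : 0 < δ := by positivity
  have hLδA : L * δ * A ≤ 1 / 4 := by
    have e : L * δ * A = (L * A) / (4 * (L * A + 1)) := by rw [hδ]; ring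
    rw [e, div_le_iff₀ (by positivity)]
    linarith
  have hT0 : detT a b c (0, 0, 0) = (0, 0, 0) := by simp [detT]
  have hTi : ∀ n, (detT a b c)^[n] (0, 0, 0) = (0, 0, 0) := fun n => Function.iterate_fixed hT0 n
  have hnil : ∀ x, (detT a b c)^[N] (emb3 x) = (0, 0, 0) := by
    intro x
    rw [hN, Function.iterate_succ_apply', hN0 (emb3 x) (Nat.cast_nonneg _) (Nat.cast_nonneg _)
      (Nat.cast_nonneg _), hT0]
  have hVq : ∀ x, qn (emb3 x) ≤ V x := by
    intro x
    have := Finset.single_le_sum (f := fun n => 2 ^ n * qn ((detT a b c)^[n] (emb3 x)))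
      (s := Finset.range N) (fun n _ => mul_nonneg (by positivity) (qn_nonneg _))
      (Finset.mem_range.2 (Nat.succ_pos N0))
    simp only [pow_zero, one_mul, Function.iterate_zero, id_eq] at this
    exact this
  have hVo : V (0, 0, 0) = 0 := by
    have e : emb3 (0, 0, 0) = (0, 0, 0) := by simp [emb3]
    simp only [hV, lyapR, e, hTi]
    simp [qn]
  refine harris_drift (hawkes3P a b c lam) (hawkes_nonneg a b c lam) (hawkes_sum a b c lam) V
    (fun x => lyapR_nonneg _ _ _ _ _) (3 / 4) (L * (lam + δ * lam + 1 / (4 * δ)) + 1)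
    (by norm_num) (by norm_num) (by positivity)
    (fun x => (hawkes_drift a b c lam hlam N δ hδ0 x L hL).1) (fun x => ?_) (0, 0, 0) hVo
    (fun R => ⟨Real.exp (-(lam + A * R)) ^ 3, by positivity, fun x hx =>
      hawkes_minor a b c lam hlam R x ((hVq x).trans hx)⟩)
  refine ((hawkes_drift a b c lam hlam N δ hδ0 x L hL).2).trans ?_
  have h1 : lyapR a b c N (detT a b c (emb3 x)) ≤ 1 / 2 * V x := lyapR_contr a b c N _ (hnil x)
  have h2 := (s3_le a b c lam hlam x).trans
    (add_le_add le_rfl (mul_le_mul_of_nonneg_left (hVq x) hA0))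
  have h3 := mul_le_mul_of_nonneg_left h2 (mul_nonneg hL0 hδ0.le)
  have h4 := mul_le_mul_of_nonneg_right hLδA (lyapR_nonneg a b c N (emb3 x))
  change L * δ * A * V x ≤ 1 / 4 * V x at h4
  nlinarith
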